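/- arXiv:2210.14206 — 2 statements merged into one kernel-verified Lean document; each statement's English description precedes it below -/
import Mathlib

section
/- For n >= 1, the number of flattened {1}-insertion parking functions of order n equals the n-th Bell number B(n), the number of set partitions of [n]. -/
namespace FlatPF

/-- Decomposition of a word into maximal weakly increasing runs. -/
def runs : List ℕ → List (List ℕ)
  | [] => []
  | a :: l =>
    match runs l with
    | [] => [[a]]
    | [] :: rs => [a] :: rs
    | (b :: t) :: rs => if a ≤ b then (a :: b :: t) :: rs else [a] :: (b :: t) :: rs

/-- The number of maximal weakly increasing runs of a word. -/
def numRuns (w : List ℕ) : ℕ := (runs w).length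

/-- A word is flattened if the leading values of its runs are weakly increasing. -/
def IsFlattened (w : List ℕ) : Prop :=
  List.Chain' (· ≤ ·) ((runs w).map (fun r => r.headD 0))

/-- A word is a parking function: entries in `[m]` and the weakly increasing
rearrangement `(a'_1, …, a'_m)` satisfies `a'_i ≤ i`. -/
def IsPF (w : List ℕ) : Prop :=
  (∀ x ∈ w, 1 ≤ x ∧ x ≤ w.length) ∧
  ∀ i < w.length, (w.mergeSort (· ≤ ·)).getD i 0 ≤ i + 1

/-- `w` is obtained by inserting the elements of the multiset `S` into some
permutation of `[n]`, keeping the letters of the permutation in relative order. -/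
def IsInsertion (S : Multiset ℕ) (n : ℕ) (w : List ℕ) : Prop :=
  (↑w : Multiset ℕ) = ↑(List.range' 1 n) + S ∧
  ∃ p : List ℕ, p.Perm (List.range' 1 n) ∧ p.Sublist w

/-- Flattened `S`-insertion parking functions of order `n`. -/
def flatIns (S : Multiset ℕ) (n : ℕ) : Set (List ℕ) :=
  {w | IsInsertion S n w ∧ IsFlattened w}

/-- Flattened `S`-insertion parking functions of order `n` with exactly `k` runs. -/
def flatInsK (S : Multiset ℕ) (n k : ℕ) : Set (List ℕ) :=
  {w | IsInsertion S n w ∧ IsFlattened w ∧ numRuns w = k}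

/-- `f(S; n, k)`, the number of flattened `S`-insertion parking functions of order `n`
with exactly `k` runs.  In particular `fS 0 n k` is the number of flattened
permutations of `[n]` with `k` runs. -/
noncomputable def fS (S : Multiset ℕ) (n k : ℕ) : ℕ := (flatInsK S n k).ncard

end FlatPF

namespace FlatPF

/-- The letters of a word that are smaller than their immediate predecessor. -/
def descentBottoms : List ℕ → List ℕ
  | [] => []
  | [_] => []
  | a :: b :: l => if a ≤ b then descentBottoms (b :: l) else b :: descentBottoms (b :: l)

lemma exists_runs_cons (b : ℕ) (l : List ℕ) : ∃ t rs, runs (b :: l) = (b :: t) :: rs := by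
  rw [runs]
  split <;> try split
  all_goals simp

lemma runs_map_headD_cons (a : ℕ) (l : List ℕ) :
    (runs (a :: l)).map (fun r => r.headD 0) = a :: descentBottoms (a :: l) := by
  induction l generalizing a with
  | nil => simp [runs, descentBottoms]
  | cons b l ih =>
    obtain ⟨t, rs, h⟩ := exists_runs_cons b l
    have hb := ih b
    rw [runs, descentBottoms]
    rw [h] at hb ⊢
    simp only [List.map_cons, List.headD_cons, List.cons.injEq, true_and] at hb
    by_cases hab : a ≤ b <;> simp [hab, ← hb]

lemma isFlattened_cons_iff (a : ℕ) (l : List ℕ) :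
    IsFlattened (a :: l) ↔ (a :: descentBottoms (a :: l)).Pairwise (· ≤ ·) := by
  rw [IsFlattened, runs_map_headD_cons]
  exact List.isChain_iff_pairwise

lemma descentBottoms_subset (w : List ℕ) : descentBottoms w ⊆ w := by
  induction w using descentBottoms.induct with
  | case1 => simp [descentBottoms]
  | case2 => simp [descentBottoms]
  | case3 a b l h ih =>
    rw [descentBottoms, if_pos h]
    exact List.Subset.trans ih (List.subset_cons_self _ _)
  | case4 a b l h ih =>
    rw [descentBottoms, if_neg h]
    exact List.cons_subset.2 ⟨by simp, List.Subset.trans ih (List.subset_cons_self _ _)⟩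

lemma descentBottoms_cons_of_forall_le {m : ℕ} {w : List ℕ} (h : ∀ x ∈ w, m ≤ x) :
    descentBottoms (m :: w) = descentBottoms w := by
  cases w with
  | nil => rfl
  | cons b l => rw [descentBottoms, if_pos (h b (by simp))]

lemma descentBottoms_eq_nil_iff (w : List ℕ) : descentBottoms w = [] ↔ w.Pairwise (· ≤ ·) := by
  rw [← List.isChain_iff_pairwise]
  induction w using descentBottoms.induct with
  | case1 => simp [descentBottoms]
  | case2 => simp [descentBottoms]
  | case3 a b l h ih => simp [descentBottoms, h, ih]
  | case4 a b l h ih => simp [descentBottoms, h]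

lemma descentBottoms_append_cons {m : ℕ} {u v : List ℕ} (hu : u ≠ []) (hmu : ∀ x ∈ u, m < x)
    (hmv : ∀ x ∈ v, m ≤ x) :
    descentBottoms (u ++ m :: v) = descentBottoms u ++ m :: descentBottoms v := by
  induction u using descentBottoms.induct with
  | case1 => exact absurd rfl hu
  | case2 a =>
    have : ¬ a ≤ m := by simpa using hmu
    simp [descentBottoms, this, descentBottoms_cons_of_forall_le hmv]
  | case3 a b l h ih =>
    have := ih (by simp) fun x hx => hmu x (List.mem_cons_of_mem _ hx)
    simpa [descentBottoms, h] using this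
  | case4 a b l h ih =>
    have := ih (by simp) fun x hx => hmu x (List.mem_cons_of_mem _ hx)
    simpa [descentBottoms, h] using this

lemma pairwise_descentBottoms_append_cons_iff {m : ℕ} {u v : List ℕ} (hmu : ∀ x ∈ u, m < x)
    (hmv : ∀ x ∈ v, m ≤ x) :
    (descentBottoms (u ++ m :: v)).Pairwise (· ≤ ·) ↔
      u.Pairwise (· ≤ ·) ∧ (descentBottoms v).Pairwise (· ≤ ·) := by
  rcases eq_or_ne u [] with rfl | hu
  · simp [descentBottoms_cons_of_forall_le hmv]
  rw [descentBottoms_append_cons hu hmu hmv, ← descentBottoms_eq_nil_iff u, List.pairwise_append,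
    List.pairwise_cons]
  constructor
  · rintro ⟨-, ⟨-, hv⟩, h⟩
    refine ⟨List.eq_nil_iff_forall_not_mem.2 fun x hx => ?_, hv⟩
    exact absurd (h x hx m (by simp)) (hmu x (descentBottoms_subset u hx)).not_ge
  · rintro ⟨hu, hv⟩
    simp only [hu]
    exact ⟨by simp, ⟨fun x hx => hmv x (descentBottoms_subset v hx), hv⟩, by simp⟩

/-- The arrangements of a finite set of letters whose descent bottoms increase. -/
def bottomIncreasing (s : Finset ℕ) : Set (List ℕ) :=
  {w | (w : Multiset ℕ) = s.val ∧ (descentBottoms w).Pairwise (· ≤ ·)}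

lemma finite_bottomIncreasing (s : Finset ℕ) : (bottomIncreasing s).Finite := by
  refine (s.toList.permutations.toFinset.finite_toSet).subset fun w hw => ?_
  have h : (w : Multiset ℕ) = s.toList := by rw [hw.1, Finset.coe_toList]
  simpa using Multiset.coe_eq_coe.1 h

lemma mem_iff_of_mem_bottomIncreasing {s : Finset ℕ} {w : List ℕ} (hw : w ∈ bottomIncreasing s)
    (x : ℕ) : x ∈ w ↔ x ∈ s := by
  rw [← Multiset.mem_coe, hw.1, Finset.mem_val]

lemma card_bottomIncreasing_eq_sum {s : Finset ℕ} {m : ℕ} (hm : m ∈ s) (hmin : ∀ x ∈ s, m ≤ x) :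
    Nat.card (bottomIncreasing s) =
      ∑ t ∈ (s.erase m).powerset, Nat.card (bottomIncreasing t) := by
  have (t : Finset ℕ) : Finite (bottomIncreasing t) := finite_bottomIncreasing t
  rw [← Finset.sum_coe_sort, ← Nat.card_sigma]
  have hsub (t : (s.erase m).powerset) : t.1 ⊆ s.erase m := Finset.mem_powerset.1 t.2
  have hlt {x : ℕ} (hx : x ∈ s.erase m) : m < x :=
    lt_of_le_of_ne (hmin x (Finset.mem_of_mem_erase hx)) (Finset.ne_of_mem_erase hx).symm
  let f (p : Σ t : (s.erase m).powerset, bottomIncreasing t) : bottomIncreasing s :=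
    ⟨(s.erase m \ p.1).sort ++ m :: p.2, by
      obtain ⟨t, v, hv⟩ := p
      refine ⟨?_, (pairwise_descentBottoms_append_cons_iff ?_ ?_).2 ⟨by simp, hv.2⟩⟩
      · rw [← Multiset.coe_add, ← Multiset.cons_coe, hv.1, Finset.sort_eq, Multiset.add_cons,
          Finset.sdiff_val, tsub_add_cancel_of_le (Finset.val_le_iff.2 (hsub t)), Finset.erase_val,
          Multiset.cons_erase hm]
      · intro x hx
        rw [Finset.mem_sort] at hx
        exact hlt (Finset.sdiff_subset hx)
      · intro x hx
        exact (hlt (hsub t ((mem_iff_of_mem_bottomIncreasing hv x).1 hx))).le⟩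
  refine (Nat.card_congr (Equiv.ofBijective f ⟨?_, ?_⟩)).symm
  · rintro ⟨⟨t, ht⟩, v, hv⟩ ⟨⟨t', ht'⟩, v', hv'⟩ h
    have hv'm : m ∉ v' := fun h => by
      simpa using hsub ⟨t', ht'⟩ ((mem_iff_of_mem_bottomIncreasing hv' m).1 h)
    have hvm : m ∉ v := fun h => by
      simpa using hsub ⟨t, ht⟩ ((mem_iff_of_mem_bottomIncreasing hv m).1 h)
    obtain ⟨-, -, rfl⟩ := (List.append_cons_inj_of_notMem (by simp) hvm).1
      (Subtype.ext_iff.1 h)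
    obtain rfl : t = t' := Finset.val_injective (hv.1.symm.trans hv'.1)
    rfl
  · rintro ⟨w, hw⟩
    obtain ⟨u, v, rfl⟩ := List.append_of_mem ((mem_iff_of_mem_bottomIncreasing hw m).2 hm)
    have hnd : (u ++ m :: v).Nodup := by
      rw [← Multiset.coe_nodup, hw.1]
      exact s.nodup
    obtain ⟨hnu, hnv, huv⟩ := List.nodup_append.1 hnd
    rw [List.nodup_cons] at hnv
    have hu {x : ℕ} (hx : x ∈ u) : x ∈ s.erase m :=
      Finset.mem_erase.2 ⟨huv x hx m (by simp),
        (mem_iff_of_mem_bottomIncreasing hw x).1 (by simp [hx])⟩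
    have hv {x : ℕ} (hx : x ∈ v) : x ∈ s.erase m :=
      Finset.mem_erase.2 ⟨fun h => hnv.1 (h ▸ hx),
        (mem_iff_of_mem_bottomIncreasing hw x).1 (by simp [hx])⟩
    have hpw := (pairwise_descentBottoms_append_cons_iff (fun x hx => hlt (hu hx))
      (fun x hx => (hlt (hv hx)).le)).1 hw.2
    have hset : s.erase m \ v.toFinset = u.toFinset := by
      ext x
      have := mem_iff_of_mem_bottomIncreasing hw x
      have := huv x
      simp only [List.mem_append, List.mem_cons] at *
      simp only [Finset.mem_sdiff, Finset.mem_erase, List.mem_toFinset]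
      grind
    refine ⟨⟨⟨v.toFinset, Finset.mem_powerset.2 fun x hx => hv (List.mem_toFinset.1 hx)⟩, v,
      ?_, hpw.2⟩, Subtype.ext ?_⟩
    · rw [List.toFinset_val, hnv.2.dedup]
    · change (s.erase m \ v.toFinset).sort ++ m :: v = u ++ m :: v
      rw [hset, (List.toFinset_sort _ hnu).2 hpw.1]

lemma flatIns_one_eq (n : ℕ) :
    flatIns {1} n = List.cons 1 '' bottomIncreasing (Finset.Icc 1 n) := by
  have hval : ((List.range' 1 n : List ℕ) : Multiset ℕ) = (Finset.Icc 1 n).val := rfl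
  have hone {l : List ℕ} (hl : (l : Multiset ℕ) = (Finset.Icc 1 n).val) : ∀ x ∈ l, 1 ≤ x := by
    intro x hx
    rw [← Multiset.mem_coe, hl, Finset.mem_val, Finset.mem_Icc] at hx
    exact hx.1
  ext w
  constructor
  · rintro ⟨⟨hw, -⟩, hflat⟩
    rw [hval] at hw
    cases w with
    | nil => simpa using congrArg Multiset.card hw
    | cons a l =>
      have hge : ∀ x ∈ a :: l, 1 ≤ x := fun x hx => by
        rw [← Multiset.mem_coe, hw] at hx
        simp at hx
        omega
      rw [isFlattened_cons_iff, List.pairwise_cons] at hflat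
      have hmem : 1 ∈ a :: l := by
        rw [← Multiset.mem_coe, hw]
        simp
      obtain rfl : a = 1 := by
        by_contra ha
        obtain ⟨u, v, rfl, hu⟩ :=
          List.eq_append_cons_of_mem ((List.mem_cons.1 hmem).resolve_left (Ne.symm ha))
        have h := descentBottoms_append_cons (m := 1) (u := a :: u) (v := v) (by simp)
          (fun x hx => lt_of_le_of_ne (hge x (by simp at hx ⊢; tauto))
            (by rintro rfl; simp_all)) fun x hx => hge x (by simp [hx])
        rw [List.cons_append] at h
        have := hflat.1 1 (by rw [h]; simp)
        have := hge a (by simp)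
        omega
      rw [descentBottoms_cons_of_forall_le fun x hx => hge x (List.mem_cons_of_mem _ hx)] at hflat
      refine ⟨l, ⟨?_, hflat.2⟩, rfl⟩
      rw [← Multiset.cons_coe, add_comm, Multiset.singleton_add] at hw
      exact (Multiset.cons_inj_right 1).1 hw
  · rintro ⟨l, ⟨hl, hpw⟩, rfl⟩
    refine ⟨⟨?_, l, Multiset.coe_eq_coe.1 (hl.trans hval.symm), List.sublist_cons_self _ _⟩, ?_⟩
    · rw [hval, ← Multiset.cons_coe, hl, add_comm, Multiset.singleton_add]
    · rw [isFlattened_cons_iff, descentBottoms_cons_of_forall_le (hone hl)]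
      exact List.pairwise_cons.2 ⟨fun x hx => hone hl x (descentBottoms_subset l hx), hpw⟩

end FlatPF

lemma Finpartition.card_eq_sum_powerset_erase {α : Type*} [DecidableEq α] {s : Finset α} {a : α}
    (ha : a ∈ s) :
    Nat.card (Finpartition s) = ∑ t ∈ (s.erase a).powerset, Nat.card (Finpartition t) := by
  rw [← Finset.sum_coe_sort, ← Nat.card_sigma]
  have hsub (t : (s.erase a).powerset) : t.1 ⊆ s.erase a := Finset.mem_powerset.1 t.2
  have hmem (t : (s.erase a).powerset) : a ∈ s \ t.1 :=
    Finset.mem_sdiff.2 ⟨ha, fun h => by simpa using hsub t h⟩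
  let f (p : Σ t : (s.erase a).powerset, Finpartition t.1) : Finpartition s :=
    p.2.extend (b := s \ p.1) (Finset.ne_empty_of_mem (hmem p.1)) Finset.disjoint_sdiff
      (Finset.union_sdiff_of_subset ((hsub p.1).trans (Finset.erase_subset _ _)))
  refine (Nat.card_congr (Equiv.ofBijective f ⟨?_, ?_⟩)).symm
  · have hpart (p) : (f p).part a = s \ p.1 :=
      (f p).part_eq_of_mem (Finset.mem_insert_self _ _) (hmem p.1)
    have hnot (p : Σ t : (s.erase a).powerset, Finpartition t.1) : s \ p.1 ∉ p.2.parts :=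
      fun h => by simpa using hsub p.1 (p.2.subset h (hmem p.1))
    rintro ⟨t, P⟩ ⟨t', P'⟩ h
    have hst : s \ t.1 = s \ t'.1 := by
      rw [← hpart ⟨t, P⟩, ← hpart ⟨t', P'⟩, h]
    obtain rfl : t = t' := Subtype.ext <| by
      rw [← Finset.sdiff_sdiff_eq_self ((hsub t).trans (Finset.erase_subset _ _)), hst,
        Finset.sdiff_sdiff_eq_self ((hsub t').trans (Finset.erase_subset _ _))]
    have hparts : insert (s \ t.1) P.parts = insert (s \ t.1) P'.parts :=
      congrArg Finpartition.parts h
    obtain rfl : P = P' := Finpartition.ext <| by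
      rw [← Finset.erase_insert (hnot ⟨t, P⟩), ← Finset.erase_insert (hnot ⟨t, P'⟩)]
      exact congrArg (Finset.erase · _) hparts
    rfl
  · intro Q
    have hQ : Q.part a ∈ Q.parts := Q.part_mem.2 ha
    refine ⟨⟨⟨s \ Q.part a, ?_⟩,
      Q.ofSubset (Finset.erase_subset (Q.part a) Q.parts) ?_⟩, Finpartition.ext ?_⟩
    · rw [Finset.mem_powerset, Finset.erase_eq]
      exact Finset.sdiff_subset_sdiff le_rfl (by simpa using ha)
    · ext x
      simp only [Finset.mem_sup, Finset.mem_erase, id, Finset.mem_sdiff]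
      constructor
      · rintro ⟨p, ⟨hne, hp⟩, hx⟩
        exact ⟨Q.subset hp hx, fun h => hne (Q.eq_of_mem_parts hp hQ hx h)⟩
      · rintro ⟨hx, hxa⟩
        exact ⟨Q.part x, ⟨fun h => hxa (h ▸ Q.mem_part_self.2 hx), Q.part_mem.2 hx⟩,
          Q.mem_part_self.2 hx⟩
    · change insert (s \ (s \ Q.part a)) (Q.parts.erase (Q.part a)) = Q.parts
      rw [Finset.sdiff_sdiff_eq_self (Q.part_subset a), Finset.insert_erase hQ]

lemma Nat.bell_succ_eq_sum_range (n : ℕ) :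
    (n + 1).bell = ∑ i ∈ Finset.range (n + 1), n.choose i * i.bell := by
  rw [Nat.bell_succ', Finset.Nat.sum_antidiagonal_eq_sum_range_succ_mk,
    ← Finset.sum_range_reflect]
  refine Finset.sum_congr rfl fun i hi => ?_
  have hi : i ≤ n := by simpa [Nat.lt_succ_iff] using hi
  simp [Nat.sub_sub_self hi, Nat.choose_symm hi]

lemma eq_bell_card_of_eq_sum_powerset_erase {α : Type*} [DecidableEq α] (f : Finset α → ℕ)
    (hempty : f ∅ = 1)
    (hsum : ∀ s : Finset α, s.Nonempty → ∃ a ∈ s, f s = ∑ t ∈ (s.erase a).powerset, f t)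
    (s : Finset α) : f s = s.card.bell := by
  induction s using Finset.strongInduction with
  | H s ih =>
    rcases s.eq_empty_or_nonempty with rfl | hs
    · simp [hempty]
    obtain ⟨a, ha, hfs⟩ := hsum s hs
    rw [hfs, ← Finset.card_erase_add_one ha, Nat.bell_succ_eq_sum_range]
    rw [Finset.sum_congr rfl fun t ht => ih t
      ((Finset.mem_powerset.1 ht).trans_ssubset (Finset.erase_ssubset ha))]
    simpa using Finset.sum_powerset_apply_card Nat.bell (x := s.erase a)

lemma Finpartition.card_eq_bell {α : Type*} [DecidableEq α] (s : Finset α) :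
    Nat.card (Finpartition s) = s.card.bell := by
  refine eq_bell_card_of_eq_sum_powerset_erase (fun s => Nat.card (Finpartition s)) ?_
    (fun s hs => ?_) s
  · exact Nat.card_unique (α := Finpartition (⊥ : Finset α))
  · obtain ⟨a, ha⟩ := hs
    exact ⟨a, ha, card_eq_sum_powerset_erase ha⟩

lemma FlatPF.card_bottomIncreasing (s : Finset ℕ) :
    Nat.card (bottomIncreasing s) = s.card.bell := by
  refine eq_bell_card_of_eq_sum_powerset_erase (fun s => Nat.card (bottomIncreasing s)) ?_
    (fun s hs => ?_) s
  · have : bottomIncreasing ∅ = {[]} := by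
      ext w
      simp only [bottomIncreasing, Finset.empty_val, Multiset.coe_eq_zero, Set.mem_ofPred_eq,
        Set.mem_singleton_iff, and_iff_left_iff_imp]
      rintro rfl
      simp [descentBottoms]
    simp [this]
  · exact ⟨s.min' hs, s.min'_mem hs,
      card_bottomIncreasing_eq_sum (s.min'_mem hs) fun x hx => s.min'_le x hx⟩

open FlatPF in
/-- The number of flattened `{1}`-insertion parking functions of order `n` equals the
`n`-th Bell number, i.e. the number of set partitions of `[n]`. -/
theorem stmt14 (n : ℕ) (hn : 1 ≤ n) :
    (flatIns {1} n).ncard =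
      Nat.card (Finpartition (Finset.univ : Finset (Fin n))) := by
  rw [flatIns_one_eq, Set.ncard_image_of_injective _ (List.cons_injective),
    ← Nat.card_coe_set_eq, card_bottomIncreasing, Finpartition.card_eq_bell]
  simp
end

section
/- For n >= 1, k >= 0, and r >= 1, the number of flattened 1_r-insertion parking functions of order n+1 with exactly k+1 runs equals B_k(n, r), the number of set partitions of [n+r] in which the integers 1, 2, ..., r lie in pairwise distinct blocks and exactly k blocks have at least two elements. Consequently, summing over k, the total number of flattened 1_r-insertion parking functions of order n+1 equals the r-Bell number B(n, r). -/
namespace FlatPF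

/-- The descent bottoms of a word: letters strictly smaller than their left neighbour. -/
def descBots : List ℕ → List ℕ
  | [] => []
  | [_] => []
  | a :: b :: l => if a ≤ b then descBots (b :: l) else b :: descBots (b :: l)

theorem runs_cons_ne_nil (a : ℕ) (l : List ℕ) :
    ∃ t rs, runs (a :: l) = (a :: t) :: rs := by
  simp only [runs]
  split
  · exact ⟨_, _, rfl⟩
  · exact ⟨_, _, rfl⟩
  · split_ifs <;> exact ⟨_, _, rfl⟩

theorem map_headD_runs (a : ℕ) (l : List ℕ) :
    (runs (a :: l)).map (fun t => t.headD 0) = a :: descBots (a :: l) := by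
  induction l generalizing a with
  | nil => simp [runs, descBots]
  | cons b l ih =>
    obtain ⟨t, rs, h⟩ := runs_cons_ne_nil b l
    have ihb := ih b
    rw [h] at ihb
    rw [runs, h]
    simp only [List.map_cons, List.headD_cons, List.cons.injEq, true_and] at ihb
    by_cases hab : a ≤ b <;> simp [hab, descBots, ← ihb]

theorem numRuns_cons (a : ℕ) (l : List ℕ) :
    numRuns (a :: l) = (descBots (a :: l)).length + 1 := by
  have := congrArg List.length (map_headD_runs a l)
  simpa [numRuns] using this

theorem isFlattened_cons (a : ℕ) (l : List ℕ) :
    IsFlattened (a :: l) ↔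
      (∀ x ∈ descBots (a :: l), a ≤ x) ∧ (descBots (a :: l)).Pairwise (· ≤ ·) := by
  rw [IsFlattened, map_headD_runs]
  change List.IsChain _ _ ↔ _
  rw [List.isChain_iff_pairwise, List.pairwise_cons]

theorem mem_of_mem_descBots {a : ℕ} {l : List ℕ} {x : ℕ} (hx : x ∈ descBots (a :: l)) :
    x ∈ l := by
  induction l generalizing a with
  | nil => simp [descBots] at hx
  | cons b l ih =>
    rw [descBots] at hx
    split_ifs at hx
    · exact List.mem_cons_of_mem _ (ih hx)
    · rcases List.mem_cons.1 hx with rfl | hx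
      · exact List.mem_cons_self
      · exact List.mem_cons_of_mem _ (ih hx)

theorem le_of_le_descBots {c a : ℕ} {l : List ℕ} (hca : c ≤ a)
    (h : ∀ x ∈ descBots (a :: l), c ≤ x) : ∀ x ∈ l, c ≤ x := by
  induction l generalizing a with
  | nil => simp
  | cons b l ih =>
    rw [descBots] at h
    split_ifs at h with hab
    · have := ih (hca.trans hab) h
      simpa using ⟨hca.trans hab, this⟩
    · simp only [List.mem_cons, forall_eq_or_imp] at h ⊢
      exact ⟨h.1, ih h.1 h.2⟩

theorem descBots_append {a m : ℕ} {A v : List ℕ} (ham : a ≤ m) (hA : ∀ x ∈ A, m < x) :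
    descBots (a :: (A ++ m :: v)) =
      descBots (a :: A) ++ ((if A = [] then [] else [m]) ++ descBots (m :: v)) := by
  induction A generalizing a with
  | nil => simp [descBots, ham]
  | cons b A ih =>
    simp only [List.mem_cons, forall_eq_or_imp] at hA
    cases A with
    | nil => simp only [List.cons_append, List.nil_append, descBots]
             have := hA.1
             split_ifs <;> simp_all <;> omega
    | cons c A =>
      have key : descBots (b :: (c :: A ++ m :: v)) =
          descBots (b :: c :: A) ++ ([m] ++ descBots (m :: v)) := by
        clear ham
        obtain ⟨hb, hA⟩ := hA
        clear ih
        induction A generalizing b c with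
        | nil =>
          simp only [List.mem_cons, List.not_mem_nil, or_false, forall_eq] at hA
          simp only [List.cons_append, List.nil_append, descBots]
          have : ¬ c ≤ m := by omega
          split_ifs <;> simp_all
        | cons d A ih =>
          have hc : m < c := hA c (by simp)
          have := ih c d hc (fun x hx => hA x (List.mem_cons_of_mem _ hx))
          simp only [List.cons_append] at this ⊢
          rw [descBots, this, descBots.eq_3 b c]
          split_ifs <;> simp
      rw [List.cons_append, descBots, key, descBots.eq_3 a b]
      split_ifs <;> simp_all

theorem descBots_eq_nil_iff (a : ℕ) (l : List ℕ) :
    descBots (a :: l) = [] ↔ (a :: l).Pairwise (· ≤ ·) := by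
  rw [← List.isChain_iff_pairwise]
  induction l generalizing a with
  | nil => simp [descBots]
  | cons b l ih =>
    rw [descBots, List.isChain_cons_cons, ← ih]
    split_ifs with h <;> simp [h]

theorem append_cons_inj_of_lt {m : ℕ} {A B v w : List ℕ} (hA : ∀ x ∈ A, m < x)
    (hB : ∀ x ∈ B, m < x) (h : A ++ m :: v = B ++ m :: w) : A = B ∧ v = w := by
  induction A generalizing B with
  | nil =>
    cases B with
    | nil => simpa using h
    | cons b B =>
      have := hB b (by simp)
      simp at h
      omega
  | cons a A ih =>
    have ha := hA a (by simp)
    cases B with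
    | nil =>
      simp at h
      omega
    | cons b B =>
      simp only [List.cons_append, List.cons.injEq] at h
      obtain ⟨h1, h2⟩ := ih (fun x hx => hA x (List.mem_cons_of_mem _ hx))
        (fun x hx => hB x (List.mem_cons_of_mem _ hx)) h.2
      exact ⟨by rw [h.1, h1], h2⟩

section Blocks

variable {α : Type*} [LinearOrder α]

/-- `F` is the set of blocks of a partition of `S` such that `φ` is injective on each block. -/
structure IsBlockSet (φ : α → ℕ) (S : Finset α) (F : Finset (Finset α)) : Prop where
  empty_notMem : ∅ ∉ F
  disjoint : (F : Set (Finset α)).PairwiseDisjoint id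
  sup_eq : F.sup id = S
  injOn : ∀ b ∈ F, Set.InjOn φ b

/-- The words with content `φ(S)` such that prepending `a` gives a word with
weakly increasing descent bottoms. -/
def flatTails (φ : α → ℕ) (a : ℕ) (S : Finset α) : Set (List ℕ) :=
  {v | (v : Multiset ℕ) = S.val.map φ ∧ (descBots (a :: v)).Pairwise (· ≤ ·)}

/-- The concatenation of the blocks ordered by minimum, the minimum of each
block being moved to its end, and letters being relabelled by `φ`. -/
def blockWord (φ : α → ℕ) (S : Finset α) (F : Finset (Finset α)) : List ℕ :=
  if h : S.Nonempty then
    let A := ((F.filter (S.min' h ∈ ·)).sup id).erase (S.min' h)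
    (A.sort (· ≤ ·)).map φ ++
      φ (S.min' h) :: blockWord φ (S \ insert (S.min' h) A) (F.erase (insert (S.min' h) A))
  else []
termination_by S.card
decreasing_by
  refine Finset.card_lt_card (Finset.ssubset_iff_subset_ne.2 ⟨Finset.sdiff_subset, fun he => ?_⟩)
  have := he.ge (S.min'_mem h)
  simp at this

theorem IsBlockSet.subset {φ : α → ℕ} {S : Finset α} {F : Finset (Finset α)}
    (hF : IsBlockSet φ S F) {b : Finset α} (hb : b ∈ F) : b ⊆ S := by
  rw [← hF.sup_eq]
  exact Finset.le_sup (f := id) hb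

theorem IsBlockSet.insert_notMem {φ : α → ℕ} {S A : Finset α} {m : α} {F : Finset (Finset α)}
    (hF : IsBlockSet φ (S \ insert m A) F) : insert m A ∉ F := fun h => by
  have := hF.subset h (Finset.mem_insert_self m A)
  simp at this

theorem isBlockSet_insert {φ : α → ℕ} {S A : Finset α} {m : α} {F : Finset (Finset α)}
    (hm : m ∈ S) (hAS : A ⊆ S) (hA : Set.InjOn φ (insert m A : Finset α))
    (hF : IsBlockSet φ (S \ insert m A) F) : IsBlockSet φ S (insert (insert m A) F) where
  empty_notMem h := by
    rcases Finset.mem_insert.1 h with h | h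
    · exact Finset.insert_ne_empty _ _ h.symm
    · exact hF.empty_notMem h
  disjoint := by
    rw [Finset.coe_insert]
    refine hF.disjoint.insert fun b hb _ => ?_
    exact (Finset.disjoint_sdiff).mono_right (hF.subset hb)
  sup_eq := by
    rw [Finset.sup_insert, hF.sup_eq]
    exact Finset.union_sdiff_of_subset (Finset.insert_subset hm hAS)
  injOn b hb := by
    rcases Finset.mem_insert.1 hb with rfl | hb
    · exact hA
    · exact hF.injOn b hb

theorem IsBlockSet.exists_insert {φ : α → ℕ} (hφ : Monotone φ) {S : Finset α}
    {F : Finset (Finset α)} (hF : IsBlockSet φ S F) (hS : S.Nonempty) :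
    ∃ A F', A ⊆ S.filter (fun x => φ (S.min' hS) < φ x) ∧
      IsBlockSet φ (S \ insert (S.min' hS) A) F' ∧ F = insert (insert (S.min' hS) A) F' := by
  set m := S.min' hS with hm
  have hmS : m ∈ S := S.min'_mem hS
  obtain ⟨b, hb, hmb⟩ : ∃ b ∈ F, m ∈ b := by
    rw [← hF.sup_eq, Finset.mem_sup] at hmS
    simpa using hmS
  refine ⟨b.erase m, F.erase b, ?_, ?_, ?_⟩
  · intro x hx
    rw [Finset.mem_erase] at hx
    have hxS := hF.subset hb hx.2
    refine Finset.mem_filter.2 ⟨hxS, lt_of_le_of_ne (hφ (S.min'_le x hxS)) fun he => ?_⟩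
    exact hx.1 (hF.injOn b hb hx.2 hmb he.symm)
  · rw [Finset.insert_erase hmb]
    refine ⟨fun h => hF.empty_notMem (Finset.mem_of_mem_erase h),
      hF.disjoint.subset (by simp), ?_, fun c hc => hF.injOn c (Finset.mem_of_mem_erase hc)⟩
    have hsup : b ∪ (F.erase b).sup id = S := by
      rw [← hF.sup_eq]
      conv_rhs => rw [← Finset.insert_erase hb, Finset.sup_insert]
      rfl
    have hdisj : Disjoint b ((F.erase b).sup id) := by
      rw [Finset.disjoint_sup_right]
      intro c hc
      rw [Finset.mem_erase] at hc
      exact hF.disjoint hb hc.2 hc.1.symm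
    rw [← hsup, Finset.union_sdiff_cancel_left hdisj]
  · rw [Finset.insert_erase hmb, Finset.insert_erase hb]

theorem blockWord_empty (φ : α → ℕ) (F : Finset (Finset α)) : blockWord φ ∅ F = [] := by
  rw [blockWord]
  simp

theorem blockWord_insert {φ : α → ℕ} {S A : Finset α} {F : Finset (Finset α)}
    (hS : S.Nonempty) (hmA : S.min' hS ∉ A)
    (hF : IsBlockSet φ (S \ insert (S.min' hS) A) F) :
    blockWord φ S (insert (insert (S.min' hS) A) F) =
      (A.sort (· ≤ ·)).map φ ++ φ (S.min' hS) :: blockWord φ (S \ insert (S.min' hS) A) F := by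
  have hfilter : (insert (insert (S.min' hS) A) F).filter (S.min' hS ∈ ·) =
      {insert (S.min' hS) A} := by
    ext b
    simp only [Finset.mem_filter, Finset.mem_insert, Finset.mem_singleton]
    constructor
    · rintro ⟨h | h, hm⟩
      · exact h
      · have := hF.subset h hm
        simp at this
    · rintro rfl
      simp
  rw [blockWord, dif_pos hS]
  simp only [hfilter, Finset.sup_singleton, id, Finset.erase_insert hmA,
    Finset.erase_insert hF.insert_notMem]

variable {φ : α → ℕ}

theorem lt_of_mem_map_sort {S A : Finset α} {c : ℕ} (hA : A ⊆ S.filter (fun x => c < φ x)) :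
    ∀ x ∈ (A.sort (· ≤ ·)).map φ, c < x := by
  intro x hx
  obtain ⟨y, hy, rfl⟩ := List.mem_map.1 hx
  exact (Finset.mem_filter.1 (hA ((Finset.mem_sort _).1 hy))).2

theorem descBots_map_sort (hφ : Monotone φ) {a : ℕ} (A : Finset α) (ha : ∀ x ∈ A, a ≤ φ x) :
    descBots (a :: (A.sort (· ≤ ·)).map φ) = [] := by
  rw [descBots_eq_nil_iff, List.pairwise_cons]
  refine ⟨fun x hx => ?_, ?_⟩
  · obtain ⟨y, hy, rfl⟩ := List.mem_map.1 hx
    exact ha y ((Finset.mem_sort _).1 hy)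
  · rw [List.pairwise_map]
    exact (Finset.pairwise_sort A (· ≤ ·)).imp fun h => hφ h

theorem descBots_block (hφ : Monotone φ) {a : ℕ} {S A : Finset α} {m : α} {v : List ℕ} (ham : a ≤ φ m)
    (hA : A ⊆ S.filter (fun x => φ m < φ x)) :
    descBots (a :: ((A.sort (· ≤ ·)).map φ ++ φ m :: v)) =
      (if A = ∅ then [] else [φ m]) ++ descBots (φ m :: v) := by
  rw [descBots_append ham (lt_of_mem_map_sort hA), descBots_map_sort hφ]
  · by_cases h : A = ∅
    · simp [h]
    · have : (A.sort (· ≤ ·)).map φ ≠ [] := by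
        intro h'
        apply h
        have := congrArg List.length h'
        simpa using this
      rw [if_neg this, if_neg h]
      rfl
  · exact fun x hx => ham.trans (Finset.mem_filter.1 (hA hx)).2.le

theorem val_map_eq_add {S A : Finset α} {m : α} (hm : m ∈ S) (hmA : m ∉ A) (hA : A ⊆ S) :
    S.val.map φ = A.val.map φ + φ m ::ₘ (S \ insert m A).val.map φ := by
  have h1 : S.val = (insert m A : Finset α).val + (S \ insert m A).val := by
    have hsub : (insert m A) ⊆ S := Finset.insert_subset hm hA
    rw [Finset.sdiff_val, add_tsub_cancel_of_le (Finset.val_le_iff.2 hsub)]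
  conv_lhs => rw [h1]
  rw [Finset.insert_val_of_notMem hmA]
  simp

theorem coe_map_sort (A : Finset α) :
    (((A.sort (· ≤ ·)).map φ : List ℕ) : Multiset ℕ) = A.val.map φ := by
  rw [← Multiset.map_coe, Finset.sort_eq]

theorem le_of_mem_flatTails (hφ : Monotone φ) {S : Finset α} {m : α} {c : ℕ} {v : List ℕ} (T : Finset α)
    (hm : ∀ x ∈ S, m ≤ x) (hv : v ∈ flatTails φ c (S \ T)) :
    ∀ x ∈ v, φ m ≤ x := by
  intro x hx
  have hx' : x ∈ (v : Multiset ℕ) := hx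
  rw [hv.1, Multiset.mem_map] at hx'
  obtain ⟨y, hy, rfl⟩ := hx'
  exact hφ (hm y (Finset.mem_sdiff.1 hy).1)

theorem append_mem_flatTails (hφ : Monotone φ) {S A : Finset α} {a : ℕ} {v : List ℕ} (hS : S.Nonempty)
    (ha : ∀ x ∈ S, a ≤ φ x) (hA : A ⊆ S.filter (fun x => φ (S.min' hS) < φ x))
    (hv : v ∈ flatTails φ (φ (S.min' hS)) (S \ insert (S.min' hS) A)) :
    (A.sort (· ≤ ·)).map φ ++ φ (S.min' hS) :: v ∈ flatTails φ a S := by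
  have hm := S.min'_mem hS
  have hmA : S.min' hS ∉ A := fun h => lt_irrefl _ (Finset.mem_filter.1 (hA h)).2
  have hAS : A ⊆ S := hA.trans (Finset.filter_subset _ _)
  refine ⟨?_, ?_⟩
  · rw [val_map_eq_add hm hmA hAS, ← hv.1, ← coe_map_sort]
    simp
  · rw [descBots_block hφ (ha _ hm) hA]
    split_ifs with h
    · simpa using hv.2
    · rw [List.singleton_append, List.pairwise_cons]
      refine ⟨fun x hx => ?_, hv.2⟩
      exact le_of_mem_flatTails (m := S.min' hS) hφ _ (fun y hy => S.min'_le y hy) hv x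
        (mem_of_mem_descBots hx)

theorem exists_append_of_mem_flatTails (hφ : Monotone φ)
    (hinj : ∀ x y z, φ z < φ x → φ x = φ y → x = y) {S : Finset α} {a : ℕ} {w : List ℕ} (hS : S.Nonempty)
    (ha : ∀ x ∈ S, a ≤ φ x) (hw : w ∈ flatTails φ a S) :
    ∃ A v, A ⊆ S.filter (fun x => φ (S.min' hS) < φ x) ∧
      v ∈ flatTails φ (φ (S.min' hS)) (S \ insert (S.min' hS) A) ∧
      w = (A.sort (· ≤ ·)).map φ ++ φ (S.min' hS) :: v := by
  set m := S.min' hS with hm_def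
  have hm : m ∈ S := S.min'_mem hS
  have hmem : ∀ y, y ∈ w ↔ ∃ x ∈ S, φ x = y := fun y => by
    rw [← Multiset.mem_coe, hw.1]
    simp
  have hmw : φ m ∈ w := (hmem _).2 ⟨m, hm, rfl⟩
  obtain ⟨B, v, rfl, hB⟩ := List.eq_append_cons_of_mem hmw
  have hBlt : ∀ x ∈ B, φ m < x := fun x hx => by
    obtain ⟨y, hy, rfl⟩ := (hmem x).1 (by simp [hx])
    refine lt_of_le_of_ne (hφ (S.min'_le y hy)) fun he => hB ?_
    rwa [he]
  have hbots := hw.2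
  rw [descBots_append (ha m hm) hBlt, List.pairwise_append] at hbots
  have hBnil : descBots (a :: B) = [] := by
    by_cases hB0 : B = []
    · simp [hB0, descBots]
    · refine List.eq_nil_iff_forall_not_mem.2 fun x hx => ?_
      have h1 := hbots.2.2 x hx (φ m) (by simp [hB0])
      have h2 := hBlt x (mem_of_mem_descBots hx)
      omega
  have hBsorted : B.Pairwise (· ≤ ·) :=
    (List.pairwise_cons.1 ((descBots_eq_nil_iff a B).1 hBnil)).2
  have hinjS : ∀ x y, φ m < φ x → φ x = φ y → x = y := fun x y => hinj x y m
  have hBnodup : B.Nodup := by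
    rw [List.nodup_iff_count_le_one]
    intro c
    by_cases hc : c ∈ B
    · have hle : B.count c ≤ (S.val.map φ).count c := by
        rw [← hw.1, Multiset.coe_count, List.count_append]
        omega
      refine hle.trans ?_
      rw [Multiset.count_map]
      refine (Finset.card_le_one (s := S.filter (fun x => c = φ x))).2 fun x hx y hy => ?_
      rw [Finset.mem_filter] at hx hy
      exact hinjS x y (hx.2 ▸ hBlt c hc) (hx.2.symm.trans hy.2)
    · simp [List.count_eq_zero_of_not_mem hc]
  have hAsub : S.filter (fun x => φ x ∈ B) ⊆ S.filter (fun x => φ m < φ x) := fun x hx => by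
    rw [Finset.mem_filter] at hx ⊢
    exact ⟨hx.1, hBlt _ hx.2⟩
  have hAB : ((S.filter (fun x => φ x ∈ B)).sort (· ≤ ·)).map φ = B := by
    refine List.Perm.eq_of_pairwise' ?_ hBsorted ?_
    · rw [List.pairwise_map]
      exact (Finset.pairwise_sort _ (· ≤ ·)).imp fun h => hφ h
    · rw [List.perm_ext_iff_of_nodup _ hBnodup]
      · intro c
        simp only [List.mem_map, Finset.mem_sort, Finset.mem_filter]
        constructor
        · rintro ⟨x, hx, rfl⟩
          exact hx.2
        · intro hc
          obtain ⟨x, hx, rfl⟩ := (hmem c).1 (by simp [hc])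
          exact ⟨x, ⟨hx, hc⟩, rfl⟩
      · refine List.Nodup.map_on (fun x hx y _ h => ?_) (Finset.sort_nodup _ _)
        rw [Finset.mem_sort] at hx
        exact hinjS x y (Finset.mem_filter.1 (hAsub hx)).2 h
  have hmA : m ∉ S.filter (fun x => φ x ∈ B) := fun h =>
    lt_irrefl _ (Finset.mem_filter.1 (hAsub h)).2
  refine ⟨S.filter (fun x => φ x ∈ B), v, hAsub, ⟨?_, ?_⟩, ?_⟩
  · have h := hw.1
    rw [val_map_eq_add hm hmA (Finset.filter_subset _ _), ← coe_map_sort, hAB] at h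
    rw [← Multiset.coe_add, ← Multiset.cons_coe] at h
    exact (Multiset.cons_inj_right _).1 (add_left_cancel h)
  · exact (List.pairwise_append.1 hbots.2.1).2.1
  · rw [hAB]

theorem injOn_insert_of_subset_filter {S A : Finset α} (hinj : ∀ x y z, φ z < φ x → φ x = φ y → x = y)
    {m : α} (hA : A ⊆ S.filter (fun x => φ m < φ x)) :
    Set.InjOn φ (insert m A : Finset α) := by
  intro x hx y hy h
  rw [Finset.mem_coe, Finset.mem_insert] at hx hy
  have hlt : ∀ z ∈ A, φ m < φ z := fun z hz => (Finset.mem_filter.1 (hA hz)).2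
  rcases hx with rfl | hx
  · rcases hy with rfl | hy
    · rfl
    · exact absurd h (hlt y hy).ne
  · exact hinj x y m (hlt x hx) h

theorem card_sdiff_insert_lt {S A : Finset α} {m : α} (hm : m ∈ S) :
    (S \ insert m A).card < S.card :=
  Finset.card_lt_card (Finset.ssubset_iff_subset_ne.2
    ⟨Finset.sdiff_subset, fun he => by rw [← he] at hm; simp at hm⟩)

theorem isBlockSet_empty_iff {F : Finset (Finset α)} : IsBlockSet φ ∅ F ↔ F = ∅ := by
  constructor
  · intro hF
    refine Finset.eq_empty_of_forall_notMem fun b hb => ?_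
    have := Finset.subset_empty.1 (hF.subset hb)
    exact hF.empty_notMem (this ▸ hb)
  · rintro rfl
    exact ⟨by simp, by simp, by simp, by simp⟩

theorem blockWord_mem_flatTails (hφ : Monotone φ) {S : Finset α} {a : ℕ} {F : Finset (Finset α)}
    (ha : ∀ x ∈ S, a ≤ φ x) (hF : IsBlockSet φ S F) :
    blockWord φ S F ∈ flatTails φ a S ∧
      (descBots (a :: blockWord φ S F)).length = (F.filter (fun b => 2 ≤ b.card)).card := by
  induction hn : S.card using Nat.strong_induction_on generalizing S a F with
  | _ n ih =>
    rcases S.eq_empty_or_nonempty with rfl | hS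
    · rw [isBlockSet_empty_iff.1 hF, blockWord_empty]
      simp [flatTails, descBots]
    · obtain ⟨A, F', hA, hF', rfl⟩ := hF.exists_insert hφ hS
      have hm := S.min'_mem hS
      have hmA : S.min' hS ∉ A := fun h => lt_irrefl _ (Finset.mem_filter.1 (hA h)).2
      have hih := ih _ (hn ▸ card_sdiff_insert_lt hm) (a := φ (S.min' hS))
        (fun x hx => hφ (S.min'_le x (Finset.mem_sdiff.1 hx).1)) hF' rfl
      rw [blockWord_insert hS hmA hF']
      refine ⟨append_mem_flatTails hφ hS ha hA hih.1, ?_⟩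
      rw [descBots_block hφ (ha _ hm) hA, List.length_append, hih.2, Finset.filter_insert,
        Finset.card_insert_of_notMem hmA]
      by_cases h : A = ∅
      · simp [h]
      · have : 2 ≤ A.card + 1 := by
          have := Finset.card_pos.2 (Finset.nonempty_iff_ne_empty.2 h)
          omega
        rw [if_neg h, if_pos this, Finset.card_insert_of_notMem
          (fun hmem => hF'.insert_notMem (Finset.mem_filter.1 hmem).1)]
        simp [add_comm]

theorem blockWord_injOn (hφ : Monotone φ)
    (hinj : ∀ x y z, φ z < φ x → φ x = φ y → x = y) (S : Finset α) :
    Set.InjOn (blockWord φ S) {F | IsBlockSet φ S F} := by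
  induction hn : S.card using Nat.strong_induction_on generalizing S with
  | _ n ih =>
    intro F hF G hG h
    rcases S.eq_empty_or_nonempty with rfl | hS
    · rw [isBlockSet_empty_iff.1 hF, isBlockSet_empty_iff.1 hG]
    · obtain ⟨A, F', hA, hF', rfl⟩ := IsBlockSet.exists_insert hφ hF hS
      obtain ⟨B, G', hB, hG', rfl⟩ := IsBlockSet.exists_insert hφ hG hS
      have hm := S.min'_mem hS
      have hmA : S.min' hS ∉ A := fun h => lt_irrefl _ (Finset.mem_filter.1 (hA h)).2
      have hmB : S.min' hS ∉ B := fun h => lt_irrefl _ (Finset.mem_filter.1 (hB h)).2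
      rw [blockWord_insert hS hmA hF', blockWord_insert hS hmB hG'] at h
      obtain ⟨h1, h2⟩ := append_cons_inj_of_lt (lt_of_mem_map_sort hA) (lt_of_mem_map_sort hB) h
      have hsub : ∀ C D : Finset α, C ⊆ S.filter (fun x => φ (S.min' hS) < φ x) →
          (C.sort (· ≤ ·)).map φ = (D.sort (· ≤ ·)).map φ → C ⊆ D := by
        intro C D hC hCD x hx
        have : φ x ∈ (D.sort (· ≤ ·)).map φ := by
          rw [← hCD]
          exact List.mem_map_of_mem ((Finset.mem_sort _).2 hx)
        obtain ⟨y, hy, hyx⟩ := List.mem_map.1 this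
        rw [hinj x y _ (Finset.mem_filter.1 (hC hx)).2 hyx.symm]
        exact (Finset.mem_sort _).1 hy
      obtain rfl : A = B := (hsub A B hA h1).antisymm (hsub B A hB h1.symm)
      rw [ih _ (hn ▸ card_sdiff_insert_lt hm) _ rfl hF' hG' h2]

theorem blockWord_surjOn (hφ : Monotone φ)
    (hinj : ∀ x y z, φ z < φ x → φ x = φ y → x = y) {S : Finset α} {a : ℕ} (ha : ∀ x ∈ S, a ≤ φ x) :
    Set.SurjOn (blockWord φ S) {F | IsBlockSet φ S F} (flatTails φ a S) := by
  induction hn : S.card using Nat.strong_induction_on generalizing S a with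
  | _ n ih =>
    intro w hw
    rcases S.eq_empty_or_nonempty with rfl | hS
    · refine ⟨∅, isBlockSet_empty_iff.2 rfl, ?_⟩
      have := hw.1
      simp only [Finset.empty_val, Multiset.map_zero, Multiset.coe_eq_zero] at this
      rw [blockWord_empty, this]
    · obtain ⟨A, v, hA, hv, rfl⟩ := exists_append_of_mem_flatTails hφ hinj hS ha hw
      have hm := S.min'_mem hS
      have hmA : S.min' hS ∉ A := fun h => lt_irrefl _ (Finset.mem_filter.1 (hA h)).2
      obtain ⟨F, hF, rfl⟩ := ih _ (hn ▸ card_sdiff_insert_lt hm)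
        (fun x hx => hφ (S.min'_le x (Finset.mem_sdiff.1 hx).1)) rfl hv
      exact ⟨_, isBlockSet_insert hm (hA.trans (Finset.filter_subset _ _))
        (injOn_insert_of_subset_filter hinj hA) hF, blockWord_insert hS hmA hF⟩

/-- Partitions of `S` with a property of the blocks correspond to their block sets. -/
theorem card_finpartition_eq_ncard {S : Finset α} {p : Finset (Finset α) → Prop}
    {q : Finset (Finset α) → Prop}
    (h : ∀ F, q F ↔ (∀ b ∈ F, Set.InjOn φ b) ∧ p F) :
    Nat.card {P : Finpartition S // q P.parts} = {F | IsBlockSet φ S F ∧ p F}.ncard := by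
  rw [← Nat.card_coe_set_eq]
  refine Nat.card_congr
    { toFun := fun P => ⟨P.1.parts, ⟨P.1.bot_notMem, P.1.disjoint, P.1.sup_parts,
        ((h _).1 P.2).1⟩, ((h _).1 P.2).2⟩
      invFun := fun F => ⟨⟨F.1, Finset.supIndep_iff_pairwiseDisjoint.2 F.2.1.disjoint,
        F.2.1.sup_eq, F.2.1.empty_notMem⟩, (h _).2 ⟨F.2.1.injOn, F.2.2⟩⟩
      left_inv := fun P => rfl
      right_inv := fun F => rfl }

end Blocks

theorem isInsertion_iff (S : Multiset ℕ) (n : ℕ) (w : List ℕ)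
    (hS : ∀ x ∈ S, x ∈ List.range' 1 n) :
    IsInsertion S n w ↔ (w : Multiset ℕ) = ↑(List.range' 1 n) + S := by
  refine ⟨fun h => h.1, fun h => ⟨h, w.dedup, ?_, List.dedup_sublist w⟩⟩
  rw [List.perm_ext_iff_of_nodup (List.nodup_dedup w) List.nodup_range']
  intro x
  rw [List.mem_dedup, ← Multiset.mem_coe, h, Multiset.mem_add, Multiset.mem_coe]
  exact ⟨fun h => h.elim id (hS x), Or.inl⟩

/-- The letter of an insertion word attached to an element of `[n+r]`: the first `r`
elements become ones, the others become `2, 3, …`. -/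
def letter (n r : ℕ) (x : Fin (n + r)) : ℕ := max 1 (x.val + 2 - r)

theorem letter_monotone (n r : ℕ) : Monotone (letter n r) := by
  intro x y h
  have : x.val ≤ y.val := h
  unfold letter
  omega

theorem letter_inj (n r : ℕ) (x y z : Fin (n + r)) (hz : letter n r z < letter n r x)
    (h : letter n r x = letter n r y) : x = y := by
  unfold letter at *
  omega

theorem injOn_letter_iff (n r : ℕ) (b : Finset (Fin (n + r))) :
    Set.InjOn (letter n r) b ↔ (b.filter (fun x => x.val < r)).card ≤ 1 := by
  rw [Finset.card_le_one]
  simp only [Finset.mem_filter]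
  constructor
  · intro h x hx y hy
    refine h hx.1 hy.1 ?_
    have := hx.2
    have := hy.2
    unfold letter
    omega
  · intro h x hx y hy hxy
    by_cases hxr : x.val < r ∧ y.val < r
    · exact h x ⟨hx, hxr.1⟩ y ⟨hy, hxr.2⟩
    · unfold letter at hxy
      omega

theorem one_cons_map_letter (n r : ℕ) :
    1 ::ₘ (Finset.univ : Finset (Fin (n + r))).val.map (letter n r) =
      (List.range' 1 (n + 1) : Multiset ℕ) + Multiset.replicate r 1 := by
  have h1 : (Finset.univ : Finset (Fin (n + r))).val.map (letter n r) =
      ((List.range (n + r)).map (fun x => max 1 (x + 2 - r)) : List ℕ) := by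
    rw [Fin.univ_val_map, ← List.map_coe_finRange_eq_range, List.map_map, List.ofFn_eq_map]
    rfl
  have h2 : (List.range r).map (fun x => max 1 (x + 2 - r)) = List.replicate r 1 := by
    refine List.eq_replicate_iff.2 ⟨by simp, fun b hb => ?_⟩
    obtain ⟨x, hx, rfl⟩ := List.mem_map.1 hb
    rw [List.mem_range] at hx
    omega
  have h3 : ((List.range n).map (r + ·)).map (fun x => max 1 (x + 2 - r)) =
      List.range' 2 n := by
    rw [List.map_map, List.range'_eq_map_range]
    refine List.map_congr_left fun x _ => ?_
    simp only [Function.comp]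
    omega
  rw [h1, Nat.add_comm n r, List.range_add, List.map_append, h2, h3, List.range'_succ,
    ← Multiset.coe_add, ← Multiset.cons_coe 1 (List.range' _ _), Multiset.coe_replicate, Multiset.cons_add, add_comm]

/-- Flattened insertion words are `1` followed by a flat tail. -/
theorem flatIns_eq_image (n r : ℕ) :
    flatIns (Multiset.replicate r 1) (n + 1) =
      List.cons 1 '' flatTails (letter n r) 1 Finset.univ := by
  have hrep : ∀ x ∈ Multiset.replicate r 1, x ∈ List.range' 1 (n + 1) := by
    intro x hx
    rw [Multiset.eq_of_mem_replicate hx]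
    simp
  ext w
  simp only [flatIns, Set.mem_ofPred_eq, isInsertion_iff _ _ _ hrep, ← one_cons_map_letter,
    Set.mem_image]
  constructor
  · rintro ⟨hw, hf⟩
    cases w with
    | nil => exact absurd hw.symm Multiset.cons_ne_zero
    | cons a v =>
      rw [isFlattened_cons] at hf
      have h1 : 1 ∈ a :: v := by
        rw [← Multiset.mem_coe, hw]
        simp
      have ha : a ∈ (1 ::ₘ (Finset.univ : Finset (Fin (n + r))).val.map (letter n r)) := by
        rw [← hw]
        simp
      have hle : a ≤ 1 := by
        rcases List.mem_cons.1 h1 with h | h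
        · exact h.ge
        · exact le_of_le_descBots le_rfl hf.1 1 h
      have hge : 1 ≤ a := by
        rcases Multiset.mem_cons.1 ha with h | h
        · exact h.ge
        · obtain ⟨x, _, rfl⟩ := Multiset.mem_map.1 h
          exact le_max_left _ _
      obtain rfl : a = 1 := le_antisymm hle hge
      rw [← Multiset.cons_coe, Multiset.cons_inj_right] at hw
      exact ⟨v, ⟨hw, hf.2⟩, rfl⟩
  · rintro ⟨v, ⟨hv, hf⟩, rfl⟩
    refine ⟨by rw [← Multiset.cons_coe, hv], (isFlattened_cons 1 v).2 ⟨fun x hx => ?_, hf⟩⟩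
    have hx' : x ∈ (v : Multiset ℕ) := mem_of_mem_descBots hx
    rw [hv] at hx'
    obtain ⟨y, _, rfl⟩ := Multiset.mem_map.1 hx'
    exact le_max_left _ _

/-- The map from block sets to flattened insertion words. -/
theorem bijOn_cons_blockWord (n r : ℕ) :
    Set.BijOn (fun F => 1 :: blockWord (letter n r) Finset.univ F)
      {F | IsBlockSet (letter n r) Finset.univ F}
      (flatIns (Multiset.replicate r 1) (n + 1)) := by
  have ha : ∀ x ∈ (Finset.univ : Finset (Fin (n + r))), 1 ≤ letter n r x :=
    fun x _ => le_max_left _ _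
  rw [flatIns_eq_image]
  refine Set.BijOn.comp (g := List.cons 1) (List.cons_injective.injOn.bijOn_image)
    ⟨fun F hF => (blockWord_mem_flatTails (letter_monotone n r) ha hF).1,
      blockWord_injOn (letter_monotone n r) (letter_inj n r) _,
      blockWord_surjOn (letter_monotone n r) (letter_inj n r) ha⟩

theorem numRuns_cons_blockWord (n r : ℕ) {F : Finset (Finset (Fin (n + r)))}
    (hF : IsBlockSet (letter n r) Finset.univ F) :
    numRuns (1 :: blockWord (letter n r) Finset.univ F) =
      (F.filter (fun b => 2 ≤ b.card)).card + 1 := by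
  rw [numRuns_cons, (blockWord_mem_flatTails (letter_monotone n r)
    (fun x _ => le_max_left _ _) hF).2]

end FlatPF

open FlatPF in
/-- The flattened `1_r`-insertion parking functions of order `n+1` with `k+1` runs are
counted by `B_k(n,r)`: set partitions of `[n+r]` in which the first `r` elements lie
in pairwise distinct blocks and exactly `k` blocks have at least two elements.
Summing over `k`, the total number is the `r`-Bell number `B(n,r)`. -/
theorem stmt19 (n k r : ℕ) (hn : 1 ≤ n) (hr : 1 ≤ r) :
    fS (Multiset.replicate r 1) (n + 1) (k + 1) =
      Nat.card {P : Finpartition (Finset.univ : Finset (Fin (n + r))) //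
        (∀ b ∈ P.parts, (b.filter (fun x => x.val < r)).card ≤ 1) ∧
        (P.parts.filter (fun b => 2 ≤ b.card)).card = k} ∧
    (flatIns (Multiset.replicate r 1) (n + 1)).ncard =
      Nat.card {P : Finpartition (Finset.univ : Finset (Fin (n + r))) //
        ∀ b ∈ P.parts, (b.filter (fun x => x.val < r)).card ≤ 1} := by
  have hbij := bijOn_cons_blockWord n r
  constructor
  · rw [card_finpartition_eq_ncard (φ := letter n r)
      (p := fun F => (F.filter (fun b => 2 ≤ b.card)).card = k)
      (q := fun F => (∀ b ∈ F, (b.filter (fun x => x.val < r)).card ≤ 1) ∧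
        (F.filter (fun b => 2 ≤ b.card)).card = k)
      (fun F => by simp only [injOn_letter_iff])]
    have himage : flatInsK (Multiset.replicate r 1) (n + 1) (k + 1) =
        (fun F => 1 :: blockWord (letter n r) Finset.univ F) ''
          {F | IsBlockSet (letter n r) Finset.univ F ∧
            (F.filter (fun b => 2 ≤ b.card)).card = k} := by
      ext w
      constructor
      · rintro ⟨h1, h2, h3⟩
        obtain ⟨F, hF, rfl⟩ := hbij.surjOn ⟨h1, h2⟩
        rw [numRuns_cons_blockWord n r hF] at h3
        exact ⟨F, ⟨hF, Nat.succ_injective h3⟩, rfl⟩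
      · rintro ⟨F, ⟨hF, hk⟩, rfl⟩
        have := hbij.mapsTo hF
        exact ⟨this.1, this.2, by rw [numRuns_cons_blockWord n r hF, hk]⟩
    rw [fS, himage]
    exact Set.InjOn.ncard_image (hbij.injOn.mono fun F hF => hF.1)
  · rw [card_finpartition_eq_ncard (φ := letter n r) (p := fun _ => True)
      (q := fun F => ∀ b ∈ F, (b.filter (fun x => x.val < r)).card ≤ 1)
      (fun F => by simp only [injOn_letter_iff, and_true]), ← hbij.image_eq]
    simp only [and_true]
    exact Set.InjOn.ncard_image hbij.injOn
end
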